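/- For n = 3 and for n = 4, there is no access structure Γ on n players satisfying monotonicity, no-cloning and no-redundancy that admits a pure QSS state. -/

import Mathlib

open Finset

/-- Monotonicity of an access structure on `n` players (players = `Fin n`). -/
def Monotonic {n : ℕ} (Γ : Finset (Fin n) → Prop) : Prop :=
  ∀ A B : Finset (Fin n), Γ A → A ⊆ B → Γ B

/-- No-cloning: a set is authorized iff its complement is not. -/
def NoCloning {n : ℕ} (Γ : Finset (Fin n) → Prop) : Prop :=
  ∀ A : Finset (Fin n), Γ A ↔ ¬ Γ Aᶜ

/-- `A` is a minimal authorized set of `Γ`. -/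
def IsMinimal {n : ℕ} (Γ : Finset (Fin n) → Prop) (A : Finset (Fin n)) : Prop :=
  Γ A ∧ ∀ B : Finset (Fin n), B ⊂ A → ¬ Γ B

/-- No-redundancy: every player lies in some minimal authorized set. -/
def NoRedundancy {n : ℕ} (Γ : Finset (Fin n) → Prop) : Prop :=
  ∀ i : Fin n, ∃ A : Finset (Fin n), IsMinimal Γ A ∧ i ∈ A

noncomputable section

/-- Combine an assignment on `A` and one on `Aᶜ` into a full bit string. -/
def glue {m : ℕ} (A : Finset (Fin m)) (u : {x // x ∈ A} → Fin 2)
    (w : {x // x ∈ Aᶜ} → Fin 2) : Fin m → Fin 2 :=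
  fun x => if h : x ∈ A then u ⟨x, h⟩ else w ⟨x, Finset.mem_compl.mpr h⟩

/-- Reduced density matrix of the pure state `ψ` on the qubit positions in `A`:
the partial trace over the positions outside `A` of `ψψ†`. -/
def reducedDensity {m : ℕ} (ψ : (Fin m → Fin 2) → ℂ) (A : Finset (Fin m)) :
    Matrix ({x // x ∈ A} → Fin 2) ({x // x ∈ A} → Fin 2) ℂ :=
  fun u v => ∑ w : {x // x ∈ Aᶜ} → Fin 2,
    ψ (glue A u w) * (starRingEnd ℂ) (ψ (glue A v w))

/-- The reduction of `ψ` to `A` is maximally mixed, i.e. equals `2^{-|A|} · I`. -/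
def MaximallyMixed {m : ℕ} (ψ : (Fin m → Fin 2) → ℂ) (A : Finset (Fin m)) : Prop :=
  reducedDensity ψ A =
    ((2 : ℂ) ^ A.card)⁻¹ •
      (1 : Matrix ({x // x ∈ A} → Fin 2) ({x // x ∈ A} → Fin 2) ℂ)

open Classical in
/-- Von Neumann entropy (natural logarithm): sum of `-λ log λ` over the eigenvalues. -/
def vnEntropy {ι : Type} [Fintype ι] [DecidableEq ι] (ρ : Matrix ι ι ℂ) : ℝ :=
  if h : ρ.IsHermitian then ∑ i, Real.negMulLog (h.eigenvalues i) else 0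

/-- Entropy of the reduction of `ψ` to the set `A` of qubit positions. -/
def Sent {m : ℕ} (ψ : (Fin m → Fin 2) → ℂ) (A : Finset (Fin m)) : ℝ :=
  vnEntropy (reducedDensity ψ A)

/-- The qubit positions (in `{0,1,…,n} = Fin (n+1)`, where `0` is the reference qubit)
of a set of players `A ⊆ Fin n`: player `i` holds position `i.succ`. -/
def posOf {n : ℕ} (A : Finset (Fin n)) : Finset (Fin (n + 1)) := A.image Fin.succ

/-- `ψ` is a pure QSS state for the access structure `Γ`: a normalized pure state of
`n+1` qubits (position `0` being the reference qubit `R`) satisfying Recoverability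
`S(R) + S(A) - S(R ∪ A) = 2 log 2` for authorized `A` and Secrecy
`S(R) + S(B) - S(R ∪ B) = 0` for unauthorized `B`. -/
structure IsPureQSSState {n : ℕ} (Γ : Finset (Fin n) → Prop)
    (ψ : (Fin (n + 1) → Fin 2) → ℂ) : Prop where
  normalized : ∑ x : Fin (n + 1) → Fin 2, ‖ψ x‖ ^ 2 = 1
  recover : ∀ A : Finset (Fin n), Γ A →
    Sent ψ {0} + Sent ψ (posOf A) - Sent ψ (insert 0 (posOf A)) = 2 * Real.log 2
  secrecy : ∀ B : Finset (Fin n), ¬ Γ B →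
    Sent ψ {0} + Sent ψ (posOf B) - Sent ψ (insert 0 (posOf B)) = 0

end


open Matrix ComplexOrder in
theorem vn_eq {ι : Type} [Fintype ι] [DecidableEq ι] {ρ : Matrix ι ι ℂ} (h : ρ.IsHermitian) :
    vnEntropy ρ = ∑ i, Real.negMulLog (h.eigenvalues i) := by
  unfold vnEntropy
  rw [dif_pos h]

theorem vn_roots {ι : Type} [Fintype ι] [DecidableEq ι] {ρ : Matrix ι ι ℂ} (h : ρ.IsHermitian) :
    vnEntropy ρ = (ρ.charpoly.roots.map (fun z => Real.negMulLog z.re)).sum := by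
  rw [vn_eq h, h.roots_charpoly_eq_eigenvalues, Multiset.map_map]
  simp

theorem vn_reindex {ι κ : Type} [Fintype ι] [DecidableEq ι] [Fintype κ] [DecidableEq κ]
    (e : ι ≃ κ) {ρ : Matrix ι ι ℂ} (h : ρ.IsHermitian) :
    vnEntropy (Matrix.reindex e e ρ) = vnEntropy ρ := by
  rw [vn_roots h, vn_roots (ρ := Matrix.reindex e e ρ) (by simpa using h.submatrix e.symm),
    Matrix.charpoly_reindex]

open Matrix ComplexOrder in
theorem vn_mul_comm {ι κ : Type} [Fintype ι] [DecidableEq ι] [Fintype κ] [DecidableEq κ]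
    (M : Matrix ι κ ℂ) : vnEntropy (M * Mᴴ) = vnEntropy (Mᴴ * M)ᵀ := by
  rw [vn_roots (isHermitian_mul_conjTranspose_self M),
    vn_roots (isHermitian_conjTranspose_mul_self M).transpose, charpoly_transpose]
  have h := charpoly_mul_comm' M Mᴴ
  have h1 := congrArg (fun p : Polynomial ℂ => (p.roots.map (fun z => Real.negMulLog z.re)).sum) h
  beta_reduce at h1
  have n1 := (charpoly_monic (M * Mᴴ)).ne_zero
  have n2 := (charpoly_monic (Mᴴ * M)).ne_zero
  have nX : (Polynomial.X : Polynomial ℂ) ≠ 0 := Polynomial.X_ne_zero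
  rw [Polynomial.roots_mul (mul_ne_zero (pow_ne_zero _ nX) n1),
    Polynomial.roots_mul (mul_ne_zero (pow_ne_zero _ nX) n2)] at h1
  simpa [Multiset.map_nsmul, Multiset.sum_nsmul] using h1

open Matrix ComplexOrder in
theorem vn_le_diag {ι : Type} [Fintype ι] [DecidableEq ι] {ρ : Matrix ι ι ℂ} (h : ρ.PosSemidef)
    (U : Matrix ι ι ℂ) (hU : U ∈ unitaryGroup ι ℂ) :
    vnEntropy ρ ≤ ∑ k, Real.negMulLog ((Uᴴ * ρ * U) k k).re := by
  rw [vn_eq h.1]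
  set V := h.1.eigenvectorUnitary with hV
  have hW : Uᴴ * (V : Matrix ι ι ℂ) ∈ unitaryGroup ι ℂ :=
    mul_mem (Unitary.star_mem hU) V.2
  set W := Uᴴ * (V : Matrix ι ι ℂ) with hWd
  have hρ : Uᴴ * ρ * U = W * diagonal (fun i => (h.1.eigenvalues i : ℂ)) * Wᴴ := by
    conv_lhs => rw [h.1.spectral_theorem, Unitary.conjStarAlgAut_apply]
    simp only [hWd, Matrix.conjTranspose_mul, Matrix.conjTranspose_conjTranspose, Matrix.mul_assoc, star_eq_conjTranspose]
    rfl
  have hrow : ∀ k, ∑ i, Complex.normSq (W k i) = 1 := by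
    intro k
    have := congrFun (congrFun (mem_unitaryGroup_iff.1 hW) k) k
    simp only [Matrix.mul_apply, star_apply, one_apply_eq] at this
    have h2 := congrArg Complex.re this
    simpa [Complex.mul_conj] using h2
  have hcol : ∀ i, ∑ k, Complex.normSq (W k i) = 1 := by
    intro i
    have := congrFun (congrFun (mem_unitaryGroup_iff'.1 hW) i) i
    simp only [Matrix.mul_apply, star_apply, one_apply_eq] at this
    have h2 := congrArg Complex.re this
    simpa [mul_comm, Complex.mul_conj, Complex.normSq_apply] using h2
  have hd : ∀ k, ((Uᴴ * ρ * U) k k).re = ∑ i, Complex.normSq (W k i) * h.1.eigenvalues i := by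
    intro k
    rw [hρ, Matrix.mul_apply]
    simp only [mul_diagonal, conjTranspose_apply, Complex.re_sum]
    refine Finset.sum_congr rfl fun i _ => ?_
    simp [Complex.normSq_apply]
    ring
  have hJ : ∀ k, ∑ i, Complex.normSq (W k i) * Real.negMulLog (h.1.eigenvalues i) ≤
      Real.negMulLog ((Uᴴ * ρ * U) k k).re := by
    intro k
    rw [hd]
    have := Real.concaveOn_negMulLog.le_map_sum (t := Finset.univ)
      (w := fun i => Complex.normSq (W k i)) (p := h.1.eigenvalues)
      (fun i _ => Complex.normSq_nonneg _) (hrow k) (fun i _ => h.eigenvalues_nonneg i)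
    simpa using this
  refine le_trans (le_of_eq ?_) (Finset.sum_le_sum fun k _ => hJ k)
  rw [Finset.sum_comm]
  refine Finset.sum_congr rfl fun i _ => ?_
  rw [← Finset.sum_mul, hcol, one_mul]

theorem classical_subadd {α β : Type} [Fintype α] [Fintype β] (D : α → β → ℝ)
    (h0 : ∀ a b, 0 ≤ D a b) (h1 : ∑ a, ∑ b, D a b = 1) :
    ∑ a, ∑ b, Real.negMulLog (D a b) ≤
      ∑ a, Real.negMulLog (∑ b, D a b) + ∑ b, Real.negMulLog (∑ a, D a b) := by
  set p : α → ℝ := fun a => ∑ b, D a b with hp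
  set q : β → ℝ := fun b => ∑ a, D a b with hq
  have key : ∀ a b, Real.negMulLog (D a b) ≤
      - D a b * Real.log (p a) - D a b * Real.log (q b) + (p a * q b - D a b) := by
    intro a b
    have hpa : D a b ≤ p a := Finset.single_le_sum (f := fun b => D a b) (fun b _ => h0 a b) (Finset.mem_univ b)
    have hqb : D a b ≤ q b := Finset.single_le_sum (f := fun a => D a b) (fun a _ => h0 a b) (Finset.mem_univ a)
    rcases (h0 a b).eq_or_lt with h | h
    · rw [← h] at hpa hqb ⊢
      simpa using mul_nonneg hpa hqb
    · have hp0 : 0 < p a := by linarith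
      have hq0 : 0 < q b := by linarith
      have := Real.log_le_sub_one_of_pos (x := p a * q b / D a b) (by positivity)
      rw [Real.log_div (by positivity) h.ne', Real.log_mul hp0.ne' hq0.ne'] at this
      have h3 := mul_le_mul_of_nonneg_left this h.le
      have h4 : D a b * (p a * q b / D a b - 1) = p a * q b - D a b := by field_simp
      rw [h4] at h3
      unfold Real.negMulLog
      linarith
  have hq1 : ∑ b, q b = 1 := by rw [← h1, Finset.sum_comm]
  have hp1 : ∑ a, p a = 1 := h1
  calc _ ≤ ∑ a, ∑ b, (- D a b * Real.log (p a) - D a b * Real.log (q b) + (p a * q b - D a b)) :=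
        Finset.sum_le_sum fun a _ => Finset.sum_le_sum fun b _ => key a b
    _ = _ := by
      simp only [Finset.sum_add_distrib, Finset.sum_sub_distrib]
      rw [h1]
      have e1 : ∑ a, ∑ b, p a * q b = 1 := by
        simp only [← Finset.mul_sum, hq1, mul_one, hp1]
      have e2 : ∑ a, ∑ b, - D a b * Real.log (p a) = ∑ a, Real.negMulLog (p a) := by
        refine Finset.sum_congr rfl fun a _ => ?_
        rw [← Finset.sum_mul, Finset.sum_neg_distrib]
        rfl
      have e3 : ∑ a, ∑ b, D a b * Real.log (q b) = - ∑ b, Real.negMulLog (q b) := by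
        rw [Finset.sum_comm, ← Finset.sum_neg_distrib]
        refine Finset.sum_congr rfl fun a _ => ?_
        rw [← Finset.sum_mul]
        simp [Real.negMulLog, hq]
      rw [e1, e2, e3]
      ring

open Matrix ComplexOrder in
theorem eig_diag {ι : Type} [Fintype ι] [DecidableEq ι] {ρ : Matrix ι ι ℂ} (h : ρ.IsHermitian) (a : ι) :
    ∑ i, ∑ j, star ((h.eigenvectorUnitary : Matrix ι ι ℂ) i a) * ρ i j *
      (h.eigenvectorUnitary : Matrix ι ι ℂ) j a = h.eigenvalues a := by
  have := congrFun (congrFun h.conjStarAlgAut_star_eigenvectorUnitary a) a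
  rw [Unitary.conjStarAlgAut_star_apply] at this
  simp only [Matrix.mul_apply, diagonal_apply_eq, star_apply, Finset.sum_mul] at this
  rw [Finset.sum_comm]
  exact this

open Matrix ComplexOrder in
theorem unit_rows {ι : Type} [Fintype ι] [DecidableEq ι] (U : unitaryGroup ι ℂ) (i j : ι) :
    ∑ b, star ((U : Matrix ι ι ℂ) i b) * (U : Matrix ι ι ℂ) j b = if i = j then 1 else 0 := by
  have := congrFun (congrFun (mem_unitaryGroup_iff.1 U.2) j) i
  simp only [Matrix.mul_apply, star_apply, one_apply] at this
  simp only [mul_comm, eq_comm (a := i)] at *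
  exact this

open Matrix ComplexOrder in
theorem vn_subadd {α β : Type} [Fintype α] [Fintype β] [DecidableEq α] [DecidableEq β]
    {ρ : Matrix (α × β) (α × β) ℂ} (h : ρ.PosSemidef) (ht : ρ.trace = 1)
    {ρA : Matrix α α ℂ} {ρB : Matrix β β ℂ} (hA : ρA.IsHermitian) (hB : ρB.IsHermitian)
    (eA : ∀ a a', ρA a a' = ∑ b, ρ (a, b) (a', b))
    (eB : ∀ b b', ρB b b' = ∑ a, ρ (a, b) (a, b')) :
    vnEntropy ρ ≤ vnEntropy ρA + vnEntropy ρB := by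
  set V : unitaryGroup α ℂ := hA.eigenvectorUnitary with hV
  set W : unitaryGroup β ℂ := hB.eigenvectorUnitary with hW
  set U : Matrix (α × β) (α × β) ℂ := kroneckerMap (· * ·) (V : Matrix α α ℂ) (W : Matrix β β ℂ)
  have hU : U ∈ unitaryGroup (α × β) ℂ := kronecker_mem_unitary V.2 W.2
  have h1 := vn_le_diag h U hU
  have hpsd : (Uᴴ * ρ * U).PosSemidef := h.conjTranspose_mul_mul_same U
  have hent : ∀ a b, (Uᴴ * ρ * U) (a, b) (a, b) = ∑ i, ∑ j, ∑ i', ∑ j',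
      star ((V : Matrix α α ℂ) i a) * star ((W : Matrix β β ℂ) j b) * ρ (i, j) (i', j') *
        ((V : Matrix α α ℂ) i' a * (W : Matrix β β ℂ) j' b) := by
    intro a b
    rw [Matrix.mul_apply]
    simp only [Matrix.mul_apply, conjTranspose_apply, Finset.sum_mul]
    rw [Finset.sum_comm]
    simp only [Fintype.sum_prod_type]
    simp [U, kroneckerMap_apply]
  set D : α → β → ℝ := fun a b => ((Uᴴ * ρ * U) (a, b) (a, b)).re
  have hD0 : ∀ a b, 0 ≤ D a b := fun a b =>
    (Complex.le_def.1 (hpsd.diag_nonneg (i := (a, b)))).1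
  have hDa : ∀ a, ∑ b, D a b = hA.eigenvalues a := by
    intro a
    have : ∑ b, (Uᴴ * ρ * U) (a, b) (a, b) = hA.eigenvalues a := by
      rw [← eig_diag hA a]
      simp only [hent]
      rw [Finset.sum_comm]
      refine Finset.sum_congr rfl fun i _ => ?_
      simp only [eA, Finset.mul_sum, Finset.sum_mul]
      rw [Finset.sum_comm]
      conv_rhs => rw [Finset.sum_comm]
      refine Finset.sum_congr rfl fun j _ => ?_
      rw [Finset.sum_comm]
      refine Finset.sum_congr rfl fun i' _ => ?_
      rw [Finset.sum_comm]
      have : ∀ j' : β, ∑ b, star ((V : Matrix α α ℂ) i a) * star ((W : Matrix β β ℂ) j b) * ρ (i, j) (i', j') *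
        ((V : Matrix α α ℂ) i' a * (W : Matrix β β ℂ) j' b) =
        if j = j' then star ((V : Matrix α α ℂ) i a) * ρ (i, j) (i', j') * (V : Matrix α α ℂ) i' a else 0 := by
        intro j'
        have := unit_rows W j j'
        calc _ = star ((V : Matrix α α ℂ) i a) * ρ (i, j) (i', j') * (V : Matrix α α ℂ) i' a *
            ∑ b, star ((W : Matrix β β ℂ) j b) * (W : Matrix β β ℂ) j' b := by
              rw [Finset.mul_sum]
              refine Finset.sum_congr rfl fun _ _ => by ring
          _ = _ := by rw [this]; split_ifs <;> simp
      simp only [this, Finset.sum_ite_eq, Finset.mem_univ, if_true]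
      rfl
    have := congrArg Complex.re this
    simpa [D] using this
  have hDb : ∀ b, ∑ a, D a b = hB.eigenvalues b := by
    intro b
    have : ∑ a, (Uᴴ * ρ * U) (a, b) (a, b) = hB.eigenvalues b := by
      rw [← eig_diag hB b]
      simp only [hent]
      simp only [eB, Finset.mul_sum, Finset.sum_mul]
      rw [Finset.sum_comm]
      calc _ = ∑ i, ∑ j, ∑ j', ∑ i', ∑ a, star ((V : Matrix α α ℂ) i a) * star ((W : Matrix β β ℂ) j b) * ρ (i, j) (i', j') *
        ((V : Matrix α α ℂ) i' a * (W : Matrix β β ℂ) j' b) := by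
            refine Finset.sum_congr rfl fun i _ => ?_
            rw [Finset.sum_comm]
            refine Finset.sum_congr rfl fun j _ => ?_
            rw [Finset.sum_comm]
            conv_rhs => rw [Finset.sum_comm]
            refine Finset.sum_congr rfl fun i' _ => ?_
            rw [Finset.sum_comm]
        _ = ∑ i, ∑ j, ∑ j', star ((W : Matrix β β ℂ) j b) * ρ (i, j) (i, j') * (W : Matrix β β ℂ) j' b := by
            refine Finset.sum_congr rfl fun i _ => Finset.sum_congr rfl fun j _ =>
              Finset.sum_congr rfl fun j' _ => ?_
            have : ∀ i' : α, ∑ a, star ((V : Matrix α α ℂ) i a) * star ((W : Matrix β β ℂ) j b) * ρ (i, j) (i', j') *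
              ((V : Matrix α α ℂ) i' a * (W : Matrix β β ℂ) j' b) =
              if i = i' then star ((W : Matrix β β ℂ) j b) * ρ (i, j) (i', j') * (W : Matrix β β ℂ) j' b else 0 := by
              intro i'
              have := unit_rows V i i'
              calc _ = star ((W : Matrix β β ℂ) j b) * ρ (i, j) (i', j') * (W : Matrix β β ℂ) j' b *
                  ∑ a, star ((V : Matrix α α ℂ) i a) * (V : Matrix α α ℂ) i' a := by
                    rw [Finset.mul_sum]
                    refine Finset.sum_congr rfl fun _ _ => by ring
                _ = _ := by rw [this]; split_ifs <;> simp
            simp only [this, Finset.sum_ite_eq, Finset.mem_univ, if_true]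
        _ = _ := by
            rw [Finset.sum_comm]
            refine Finset.sum_congr rfl fun j _ => ?_
            rw [Finset.sum_comm]
    have := congrArg Complex.re this
    simpa [D] using this
  have hA1 : ∑ a, hA.eigenvalues a = 1 := by
    have h2 := hA.trace_eq_sum_eigenvalues
    have h3 : ρA.trace = 1 := by
      rw [← ht]
      simp [Matrix.trace, eA, Fintype.sum_prod_type]
    rw [h3] at h2
    have := congrArg Complex.re h2
    simpa using this.symm
  have h2 := classical_subadd D hD0 (by simp only [hDa, hA1])
  simp only [hDa, hDb] at h2
  rw [vn_eq hA, vn_eq hB]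
  refine h1.trans ?_
  rw [Fintype.sum_prod_type]
  exact h2


def join {m : ℕ} (A B C : Finset (Fin m)) (u : {x // x ∈ A} → Fin 2)
    (v : {x // x ∈ B} → Fin 2) : {x // x ∈ C} → Fin 2 :=
  fun x => if h : x.1 ∈ A then u ⟨x, h⟩ else if h' : x.1 ∈ B then v ⟨x, h'⟩ else 0

def joinEquiv {m : ℕ} {A B C : Finset (Fin m)} (hd : Disjoint A B) (hC : C = A ∪ B) :
    ({x // x ∈ A} → Fin 2) × ({x // x ∈ B} → Fin 2) ≃ ({x // x ∈ C} → Fin 2) where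
  toFun p := join A B C p.1 p.2
  invFun z := (fun x => z ⟨x.1, by rw [hC]; exact Finset.mem_union_left _ x.2⟩,
    fun x => z ⟨x.1, by rw [hC]; exact Finset.mem_union_right _ x.2⟩)
  left_inv := by
    rintro ⟨u, v⟩
    ext x
    · simp [join]
    · have : x.1 ∉ A := Finset.disjoint_right.1 hd x.2
      simp [join, this]
  right_inv := by
    intro z
    funext x
    have hx : x.1 ∈ A ∪ B := hC ▸ x.2
    simp only [join]
    split_ifs with h1 h2
    · rfl
    · rfl
    · simp [h1, h2] at hx

def glueEquiv {m : ℕ} (A : Finset (Fin m)) :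
    ({x // x ∈ A} → Fin 2) × ({x // x ∈ Aᶜ} → Fin 2) ≃ (Fin m → Fin 2) where
  toFun p := glue A p.1 p.2
  invFun z := (fun x => z x.1, fun x => z x.1)
  left_inv := by
    rintro ⟨u, v⟩
    ext x
    · simp [glue]
    · have : x.1 ∉ A := Finset.mem_compl.1 x.2
      simp [glue, this]
  right_inv := by
    intro z
    funext x
    simp [glue]

open Matrix in
theorem rd_eq {m : ℕ} (ψ : (Fin m → Fin 2) → ℂ) (A : Finset (Fin m)) :
    reducedDensity ψ A = (Matrix.of fun u w => ψ (glue A u w)) *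
      (Matrix.of fun u w => ψ (glue A u w))ᴴ := by
  ext u v
  simp [reducedDensity, Matrix.mul_apply]

open Matrix ComplexOrder in
theorem rd_psd {m : ℕ} (ψ : (Fin m → Fin 2) → ℂ) (A : Finset (Fin m)) :
    (reducedDensity ψ A).PosSemidef := by
  rw [rd_eq]
  exact posSemidef_self_mul_conjTranspose _

theorem rd_herm {m : ℕ} (ψ : (Fin m → Fin 2) → ℂ) (A : Finset (Fin m)) :
    (reducedDensity ψ A).IsHermitian := (rd_psd ψ A).1

theorem rd_trace {m : ℕ} (ψ : (Fin m → Fin 2) → ℂ) (hψ : ∑ x, ‖ψ x‖ ^ 2 = 1)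
    (A : Finset (Fin m)) : (reducedDensity ψ A).trace = 1 := by
  have h : ((∑ x, ‖ψ x‖ ^ 2 : ℝ) : ℂ) = 1 := by rw [hψ]; simp
  rw [← h, ← (glueEquiv A).sum_comp, Fintype.sum_prod_type]
  simp [Matrix.trace, reducedDensity, glueEquiv, Complex.mul_conj, Complex.normSq_eq_norm_sq]

open Matrix in
theorem S_compl {m : ℕ} (ψ : (Fin m → Fin 2) → ℂ) (A : Finset (Fin m)) :
    Sent ψ Aᶜ = Sent ψ A := by
  unfold Sent
  rw [rd_eq ψ A, vn_mul_comm]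
  congr 1
  ext w w'
  simp only [reducedDensity, Matrix.mul_apply, transpose_apply, conjTranspose_apply, of_apply]
  have hs : ∀ x : Fin m, x ∈ A ↔ x ∈ Aᶜᶜ := by simp
  symm
  refine Fintype.sum_equiv (Equiv.arrowCongr (Equiv.subtypeEquivRight hs) (Equiv.refl (Fin 2))) _ _ ?_
  intro u
  have : ∀ w : {x // x ∈ Aᶜ} → Fin 2, glue A u w = glue Aᶜ w
    ((Equiv.arrowCongr (Equiv.subtypeEquivRight hs) (Equiv.refl (Fin 2))) u) := by
    intro w
    funext x
    by_cases hx : x ∈ A <;> simp [glue, hx, Equiv.arrowCongr, Equiv.subtypeEquivRight]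
    rfl
  rw [this w, this w', mul_comm]
  rfl

theorem rd_partial_left {m : ℕ} (ψ : (Fin m → Fin 2) → ℂ) {A B : Finset (Fin m)}
    (hd : Disjoint A B) (u u' : {x // x ∈ A} → Fin 2) :
    reducedDensity ψ A u u' = ∑ v, reducedDensity ψ (A ∪ B)
      (joinEquiv hd rfl (u, v)) (joinEquiv hd rfl (u', v)) := by
  have hd' : Disjoint B (A ∪ B)ᶜ := by
    rw [Finset.disjoint_left]; intro x hx; simp [hx]
  have hC : Aᶜ = B ∪ (A ∪ B)ᶜ := by
    ext x
    have := fun h : x ∈ A => Finset.disjoint_left.1 hd h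
    simp only [Finset.mem_compl, Finset.mem_union]; tauto
  unfold reducedDensity
  rw [← (joinEquiv hd' hC).sum_comp, Fintype.sum_prod_type]
  have : ∀ (u : {x // x ∈ A} → Fin 2) v w, glue A u (joinEquiv hd' hC (v, w)) =
      glue (A ∪ B) (joinEquiv hd rfl (u, v)) w := by
    intro u v w
    funext x
    by_cases hA : x ∈ A <;> by_cases hB : x ∈ B <;> simp [glue, joinEquiv, join, hA, hB]
  simp only [this]

theorem rd_partial_right {m : ℕ} (ψ : (Fin m → Fin 2) → ℂ) {A B : Finset (Fin m)}
    (hd : Disjoint A B) (v v' : {x // x ∈ B} → Fin 2) :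
    reducedDensity ψ B v v' = ∑ u, reducedDensity ψ (A ∪ B)
      (joinEquiv hd rfl (u, v)) (joinEquiv hd rfl (u, v')) := by
  have hd' : Disjoint A (A ∪ B)ᶜ := by
    rw [Finset.disjoint_left]; intro x hx; simp [hx]
  have hC : Bᶜ = A ∪ (A ∪ B)ᶜ := by
    ext x
    have := fun h : x ∈ A => Finset.disjoint_left.1 hd h
    simp only [Finset.mem_compl, Finset.mem_union]; tauto
  unfold reducedDensity
  rw [← (joinEquiv hd' hC).sum_comp, Fintype.sum_prod_type]
  have : ∀ (u : {x // x ∈ A} → Fin 2) v w, glue B v (joinEquiv hd' hC (u, w)) =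
      glue (A ∪ B) (joinEquiv hd rfl (u, v)) w := by
    intro u v w
    funext x
    have := fun h : x ∈ A => Finset.disjoint_left.1 hd h
    by_cases hA : x ∈ A <;> by_cases hB : x ∈ B <;> simp [glue, joinEquiv, join, hA, hB]
    exact absurd hB (this hA)
  simp only [this]

open Matrix ComplexOrder in
theorem S_subadd {m : ℕ} (ψ : (Fin m → Fin 2) → ℂ) (hψ : ∑ x, ‖ψ x‖ ^ 2 = 1)
    {A B : Finset (Fin m)} (hd : Disjoint A B) :
    Sent ψ (A ∪ B) ≤ Sent ψ A + Sent ψ B := by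
  unfold Sent
  set e := joinEquiv hd (rfl : A ∪ B = A ∪ B) with he
  rw [← vn_reindex e.symm (rd_herm ψ (A ∪ B))]
  refine vn_subadd ?_ ?_ (rd_herm ψ A) (rd_herm ψ B) ?_ ?_
  · exact (rd_psd ψ (A ∪ B)).submatrix e
  · rw [← rd_trace ψ hψ (A ∪ B)]
    simp only [Matrix.trace, Matrix.diag, Matrix.reindex_apply, Matrix.submatrix_apply]
    exact e.sum_comp (fun i => reducedDensity ψ (A ∪ B) i i)
  · intro a a'
    exact rd_partial_left ψ hd a a'
  · intro b b'
    exact rd_partial_right ψ hd b b'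

/-- purity -/
def pur {m : ℕ} (ψ : (Fin m → Fin 2) → ℂ) (A : Finset (Fin m)) : ℝ :=
  ∑ u, ∑ v, Complex.normSq (reducedDensity ψ A u v)

theorem pur_mono {m : ℕ} (ψ : (Fin m → Fin 2) → ℂ)
    {A B : Finset (Fin m)} (hd : Disjoint A B) :
    pur ψ A ≤ 2 ^ B.card * pur ψ (A ∪ B) := by
  unfold pur
  set e := joinEquiv hd (rfl : A ∪ B = A ∪ B) with he
  rw [← e.sum_comp, Fintype.sum_prod_type, Finset.mul_sum]
  refine Finset.sum_le_sum fun u _ => ?_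
  have h1 : ∀ u', Complex.normSq (reducedDensity ψ A u u') ≤ 2 ^ B.card *
      ∑ v, Complex.normSq (reducedDensity ψ (A ∪ B) (e (u, v)) (e (u', v))) := by
    intro u'
    rw [rd_partial_left ψ hd, Complex.normSq_eq_norm_sq]
    have h2 := norm_sum_le Finset.univ (fun v => reducedDensity ψ (A ∪ B) (e (u, v)) (e (u', v)))
    have h3 := sq_sum_le_card_mul_sum_sq (s := Finset.univ) (f := fun v => ‖reducedDensity ψ (A ∪ B) (e (u, v)) (e (u', v))‖)
    have h4 := pow_le_pow_left₀ (norm_nonneg _) h2 2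
    refine h4.trans (h3.trans (le_of_eq ?_))
    simp [Complex.normSq_eq_norm_sq]
  refine (Finset.sum_le_sum fun u' _ => h1 u').trans ?_
  rw [← Finset.mul_sum]
  refine mul_le_mul_of_nonneg_left ?_ (by positivity)
  rw [Finset.sum_comm]
  refine Finset.sum_le_sum fun v _ => ?_
  rw [← e.sum_comp, Fintype.sum_prod_type]
  refine Finset.sum_le_sum fun u' _ => ?_
  exact Finset.single_le_sum (f := fun v' => Complex.normSq (reducedDensity ψ (A ∪ B) (e (u, v)) (e (u', v'))))
    (fun _ _ => Complex.normSq_nonneg _) (Finset.mem_univ v)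

open Matrix in
theorem pur_eig {m : ℕ} (ψ : (Fin m → Fin 2) → ℂ) (A : Finset (Fin m)) :
    pur ψ A = ∑ i, (rd_herm ψ A).eigenvalues i ^ 2 := by
  set h := rd_herm ψ A
  have h1 : ((pur ψ A : ℝ) : ℂ) = (reducedDensity ψ A * reducedDensity ψ A).trace := by
    simp only [pur, Matrix.trace, Matrix.diag, Matrix.mul_apply]
    push_cast
    refine Finset.sum_congr rfl fun u _ => Finset.sum_congr rfl fun v _ => ?_
    rw [← h.apply v u, ← Complex.mul_conj]
    rfl
  have h2 : (reducedDensity ψ A * reducedDensity ψ A).trace = ∑ i, (h.eigenvalues i : ℂ) ^ 2 := by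
    conv_lhs => rw [h.spectral_theorem, ← map_mul, Unitary.conjStarAlgAut_apply, trace_mul_comm, ← mul_assoc]
    simp [Matrix.trace, sq]
  rw [h2] at h1
  exact_mod_cast h1

theorem real_facts {ι : Type} [Fintype ι] (l : ι → ℝ) (h0 : ∀ i, 0 ≤ l i) (h1 : ∑ i, l i = 1) :
    (∑ i, Real.negMulLog (l i) ≤ Real.log (Fintype.card ι)) ∧
    (Real.log (Fintype.card ι) ≤ ∑ i, Real.negMulLog (l i) → ∑ i, l i ^ 2 = (Fintype.card ι : ℝ)⁻¹) ∧
    ((Fintype.card ι : ℝ)⁻¹ ≤ ∑ i, l i ^ 2) ∧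
    (∑ i, Real.negMulLog (l i) ≤ Real.log 2 → 1 / 2 ≤ ∑ i, l i ^ 2) ∧
    0 ≤ ∑ i, Real.negMulLog (l i) := by
  have hne : Nonempty ι := by
    by_contra h
    rw [not_nonempty_iff] at h
    simp at h1
  set d : ℝ := (Fintype.card ι : ℝ) with hd
  have hd0 : 0 < d := by
    rw [hd]; exact_mod_cast Fintype.card_pos
  have key : ∀ i, Real.negMulLog (l i) ≤ l i * Real.log d + (d⁻¹ - l i) ∧
      (Real.negMulLog (l i) = l i * Real.log d + (d⁻¹ - l i) → l i = d⁻¹) := by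
    intro i
    rcases (h0 i).eq_or_lt with h | h
    · rw [← h]
      simp [hd0.le]
    · have e : l i * ((d * l i)⁻¹ - 1) = d⁻¹ - l i := by field_simp
      have e2 : Real.negMulLog (l i) = l i * Real.log d + l i * Real.log ((d * l i)⁻¹) := by
        rw [Real.log_inv, Real.log_mul hd0.ne' h.ne']
        unfold Real.negMulLog
        ring
      rw [e2, ← e]
      constructor
      · have := Real.log_le_sub_one_of_pos (x := (d * l i)⁻¹) (by positivity)
        have := mul_le_mul_of_nonneg_left this h.le
        linarith
      · intro h5
        by_contra hc
        have hc' : (d * l i)⁻¹ ≠ 1 := by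
          intro h6
          apply hc
          rw [inv_eq_one] at h6
          field_simp
          linarith
        have := Real.log_lt_sub_one_of_pos (x := (d * l i)⁻¹) (by positivity) hc'
        have := mul_lt_mul_of_pos_left this h
        linarith
  have hsum : ∑ i, (l i * Real.log d + (d⁻¹ - l i)) = Real.log d := by
    rw [Finset.sum_add_distrib, ← Finset.sum_mul, Finset.sum_sub_distrib, h1]
    simp only [Finset.sum_const, Finset.card_univ, nsmul_eq_mul, ← hd]
    field_simp
    ring
  refine ⟨?_, ?_, ?_, ?_, ?_⟩
  · rw [← hsum]
    exact Finset.sum_le_sum fun i _ => (key i).1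
  · intro h
    have h2 : ∑ i, Real.negMulLog (l i) = ∑ i, (l i * Real.log d + (d⁻¹ - l i)) :=
      le_antisymm (Finset.sum_le_sum fun i _ => (key i).1) (by rw [hsum]; exact h)
    have h3 := (Finset.sum_eq_sum_iff_of_le (fun i _ => (key i).1)).1 h2
    have h4 : ∀ i, l i = d⁻¹ := fun i => (key i).2 (h3 i (Finset.mem_univ i))
    simp only [h4]
    simp only [Finset.sum_const, Finset.card_univ, nsmul_eq_mul, ← hd]
    field_simp
  · have : 0 ≤ ∑ i, (l i - d⁻¹) ^ 2 := Finset.sum_nonneg fun i _ => sq_nonneg _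
    have e : ∀ i, (l i - d⁻¹) ^ 2 = l i ^ 2 - 2 * d⁻¹ * l i + d⁻¹ ^ 2 := fun i => by ring
    simp only [e, Finset.sum_add_distrib, Finset.sum_sub_distrib, ← Finset.mul_sum, h1] at this
    simp only [Finset.sum_const, Finset.card_univ, nsmul_eq_mul, ← hd] at this
    have e2 : d * d⁻¹ ^ 2 = d⁻¹ := by field_simp
    linarith
  · intro h
    have k2 : ∀ i, l i * Real.log 2 + l i - 2 * l i ^ 2 ≤ Real.negMulLog (l i) := by
      intro i
      rcases (h0 i).eq_or_lt with h | h
      · rw [← h]; simp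
      · have := Real.log_le_sub_one_of_pos (x := 2 * l i) (by positivity)
        rw [Real.log_mul (by norm_num) h.ne'] at this
        have := mul_le_mul_of_nonneg_left this h.le
        unfold Real.negMulLog
        linarith
    have := Finset.sum_le_sum fun i (_ : i ∈ Finset.univ) => k2 i
    simp only [Finset.sum_add_distrib, Finset.sum_sub_distrib, ← Finset.mul_sum, ← Finset.sum_mul, h1] at this
    linarith
  · refine Finset.sum_nonneg fun i _ => Real.negMulLog_nonneg (h0 i) ?_
    rw [← h1]
    exact Finset.single_le_sum (fun i _ => h0 i) (Finset.mem_univ i)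

open Matrix ComplexOrder in
theorem S_facts {m : ℕ} (ψ : (Fin m → Fin 2) → ℂ) (hψ : ∑ x, ‖ψ x‖ ^ 2 = 1)
    (A : Finset (Fin m)) :
    (Sent ψ A ≤ A.card * Real.log 2) ∧
    (A.card * Real.log 2 ≤ Sent ψ A → pur ψ A = ((2 : ℝ) ^ A.card)⁻¹) ∧
    (((2 : ℝ) ^ A.card)⁻¹ ≤ pur ψ A) ∧
    (Sent ψ A ≤ Real.log 2 → 1 / 2 ≤ pur ψ A) ∧ 0 ≤ Sent ψ A := by
  have ht : ∑ i, (rd_herm ψ A).eigenvalues i = 1 := by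
    have h2 := (rd_herm ψ A).trace_eq_sum_eigenvalues
    rw [rd_trace ψ hψ] at h2
    have := congrArg Complex.re h2
    simpa using this.symm
  have := real_facts (rd_herm ψ A).eigenvalues (fun i => (rd_psd ψ A).eigenvalues_nonneg i) ht
  rw [← pur_eig, ← vn_eq] at this
  simpa [Sent] using this

/-- swap the two copies on the positions in `S` -/
def sw {m : ℕ} (S : Finset (Fin m)) (z : (Fin m → Fin 2) × (Fin m → Fin 2)) :
    (Fin m → Fin 2) × (Fin m → Fin 2) :=
  (fun i => if i ∈ S then z.2 i else z.1 i, fun i => if i ∈ S then z.1 i else z.2 i)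

theorem sw_sw {m : ℕ} (S S' : Finset (Fin m)) (z) : sw S (sw S' z) = sw (symmDiff S S') z := by
  ext i <;> by_cases h : i ∈ S <;> by_cases h' : i ∈ S' <;> simp [sw, h, h', Finset.mem_symmDiff]

def swEquiv {m : ℕ} (S : Finset (Fin m)) :
    (Fin m → Fin 2) × (Fin m → Fin 2) ≃ (Fin m → Fin 2) × (Fin m → Fin 2) where
  toFun := sw S
  invFun := sw S
  left_inv z := by rw [sw_sw]; ext i <;> simp [sw]
  right_inv z := by rw [sw_sw]; ext i <;> simp [sw]

def dbl {m : ℕ} (ψ : (Fin m → Fin 2) → ℂ) (z : (Fin m → Fin 2) × (Fin m → Fin 2)) : ℂ :=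
  ψ z.1 * ψ z.2

theorem pur_eq {m : ℕ} (ψ : (Fin m → Fin 2) → ℂ) (A : Finset (Fin m)) :
    ((pur ψ A : ℝ) : ℂ) = ∑ z, dbl ψ z * (starRingEnd ℂ) (dbl ψ (sw A z)) := by
  have h1 : ∑ z, dbl ψ z * (starRingEnd ℂ) (dbl ψ (sw A z)) =
      ∑ u, ∑ w, ∑ v, ∑ w', ψ (glue A u w) * ψ (glue A v w') *
        (starRingEnd ℂ) (ψ (glue A v w) * ψ (glue A u w')) := by
    rw [Fintype.sum_prod_type, ← (glueEquiv A).sum_comp, Fintype.sum_prod_type]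
    refine Finset.sum_congr rfl fun u _ => Finset.sum_congr rfl fun w _ => ?_
    rw [← (glueEquiv A).sum_comp, Fintype.sum_prod_type]
    refine Finset.sum_congr rfl fun v _ => Finset.sum_congr rfl fun w' _ => ?_
    have : sw A (glueEquiv A (u, w), glueEquiv A (v, w')) = (glue A v w, glue A u w') := by
      ext i <;> by_cases h : i ∈ A <;> simp [sw, glueEquiv, glue, h]
    rw [this]
    rfl
  rw [h1]
  unfold pur
  push_cast
  refine Finset.sum_congr rfl fun u _ => ?_
  rw [Finset.sum_comm]
  refine Finset.sum_congr rfl fun v _ => ?_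
  rw [← Complex.mul_conj]
  unfold reducedDensity
  rw [map_sum, Finset.sum_mul_sum]
  refine Finset.sum_congr rfl fun w _ => Finset.sum_congr rfl fun w' _ => ?_
  simp only [map_mul, Complex.conj_conj]
  ring

theorem pur_compl {m : ℕ} (ψ : (Fin m → Fin 2) → ℂ) (A : Finset (Fin m)) :
    pur ψ Aᶜ = pur ψ A := by
  have : ((pur ψ Aᶜ : ℝ) : ℂ) = ((pur ψ A : ℝ) : ℂ) := by
    rw [pur_eq, pur_eq]
    refine Finset.sum_congr rfl fun z _ => ?_
    have : dbl ψ (sw Aᶜ z) = dbl ψ (sw A z) := by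
      have h : sw Aᶜ z = ((sw A z).2, (sw A z).1) := by
        ext i <;> by_cases h : i ∈ A <;> simp [sw, h]
      rw [h]
      simp [dbl, mul_comm]
    rw [this]
  exact_mod_cast this

theorem sgn_symmDiff {m : ℕ} (S T : Finset (Fin m)) :
    ((-1 : ℂ)) ^ S.card * (-1) ^ T.card = (-1) ^ (symmDiff S T).card := by
  have h1 : (symmDiff S T).card + 2 * (S ∩ T).card = S.card + T.card := by
    have e : symmDiff S T = (S \ T) ∪ (T \ S) := rfl
    have d : Disjoint (S \ T) (T \ S) := by
      rw [Finset.disjoint_left]; intro x; simp; tauto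
    rw [e, Finset.card_union_of_disjoint d]
    have a := Finset.card_sdiff_add_card_inter S T
    have b := Finset.card_sdiff_add_card_inter T S
    rw [Finset.inter_comm T S] at b
    omega
  rw [← pow_add, ← h1, pow_add, pow_mul]
  simp

theorem shadow {m : ℕ} (ψ : (Fin m → Fin 2) → ℂ) (T : Finset (Fin m)) :
    0 ≤ ∑ S ∈ T.powerset, (-1 : ℝ) ^ S.card * pur ψ S := by
  set F : (Fin m → Fin 2) × (Fin m → Fin 2) → ℂ :=
    fun z => ∑ S ∈ T.powerset, (-1 : ℂ) ^ S.card * dbl ψ (sw S z) with hF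
  have hov : ∀ S S' : Finset (Fin m), ∑ z, dbl ψ (sw S z) * (starRingEnd ℂ) (dbl ψ (sw S' z)) =
      ((pur ψ (symmDiff S S') : ℝ) : ℂ) := by
    intro S S'
    rw [pur_eq, ← (swEquiv S).sum_comp]
    refine Finset.sum_congr rfl fun z _ => ?_
    have e1 : sw S (swEquiv S z) = z := (swEquiv S).left_inv z
    have e2 : sw S' (swEquiv S z) = sw (symmDiff S S') z := by
      rw [symmDiff_comm, ← sw_sw]; rfl
    rw [e1, e2]
  have h1 : ((∑ z, Complex.normSq (F z) : ℝ) : ℂ) =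
      ((2 ^ T.card * ∑ S ∈ T.powerset, (-1 : ℝ) ^ S.card * pur ψ S : ℝ) : ℂ) := by
    push_cast
    calc ∑ z, (Complex.normSq (F z) : ℂ)
        = ∑ z, ∑ S ∈ T.powerset, ∑ S' ∈ T.powerset,
          ((-1 : ℂ) ^ S.card * (-1) ^ S'.card) * (dbl ψ (sw S z) * (starRingEnd ℂ) (dbl ψ (sw S' z))) := by
          refine Finset.sum_congr rfl fun z _ => ?_
          rw [← Complex.mul_conj, hF, map_sum, Finset.sum_mul_sum]
          refine Finset.sum_congr rfl fun S _ => Finset.sum_congr rfl fun S' _ => ?_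
          simp only [map_mul, map_pow, map_neg, map_one]
          ring
      _ = ∑ S ∈ T.powerset, ∑ S' ∈ T.powerset,
          (-1 : ℂ) ^ (symmDiff S S').card * ((pur ψ (symmDiff S S') : ℝ) : ℂ) := by
          rw [Finset.sum_comm]
          refine Finset.sum_congr rfl fun S _ => ?_
          rw [Finset.sum_comm]
          refine Finset.sum_congr rfl fun S' _ => ?_
          rw [← Finset.mul_sum, hov, sgn_symmDiff]
      _ = ∑ S ∈ T.powerset, ∑ S' ∈ T.powerset,
          (-1 : ℂ) ^ S'.card * ((pur ψ S' : ℝ) : ℂ) := by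
          refine Finset.sum_congr rfl fun S hS => ?_
          have hm : ∀ S' ∈ T.powerset, symmDiff S S' ∈ T.powerset := by
            intro S' hS'
            rw [Finset.mem_powerset] at *
            intro x hx
            rw [Finset.mem_symmDiff] at hx
            rcases hx with hx | hx
            · exact hS hx.1
            · exact hS' hx.1
          refine Finset.sum_nbij' (symmDiff S) (symmDiff S) hm hm ?_ ?_ ?_
          · intro a _; exact symmDiff_symmDiff_cancel_left S a
          · intro a _; exact symmDiff_symmDiff_cancel_left S a
          · intro a _; rfl
      _ = _ := by
          rw [Finset.sum_const, Finset.card_powerset]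
          simp
  have h2 : ∑ z, Complex.normSq (F z) = 2 ^ T.card * ∑ S ∈ T.powerset, (-1 : ℝ) ^ S.card * pur ψ S := by
    exact_mod_cast h1
  have h3 : 0 ≤ ∑ z, Complex.normSq (F z) := Finset.sum_nonneg fun z _ => Complex.normSq_nonneg _
  rw [h2] at h3
  exact nonneg_of_mul_nonneg_right h3 (by positivity)

theorem shadow4 {m : ℕ} (ψ : (Fin m → Fin 2) → ℂ) (o a b c : Fin m)
    (h : o ≠ a ∧ o ≠ b ∧ o ≠ c ∧ a ≠ b ∧ a ≠ c ∧ b ≠ c) :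
    0 ≤ pur ψ ∅ - pur ψ {o} - pur ψ {a} - pur ψ {b} - pur ψ {c}
      + pur ψ {o, a} + pur ψ {o, b} + pur ψ {o, c} + pur ψ {a, b} + pur ψ {a, c} + pur ψ {b, c}
      - pur ψ {o, a, b} - pur ψ {o, a, c} - pur ψ {o, b, c} - pur ψ {a, b, c}
      + pur ψ {o, a, b, c} := by
  obtain ⟨h1, h2, h3, h4, h5, h6⟩ := h
  have := shadow ψ {o, a, b, c}
  have ec : ({c} : Finset (Fin m)) = insert c ∅ := rfl
  have ia : a ∉ ({b, c} : Finset (Fin m)) := by simp [h4, h5]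
  have ib : b ∉ ({c} : Finset (Fin m)) := by simp [h6]
  have io : o ∉ ({a, b, c} : Finset (Fin m)) := by simp [h1, h2, h3]
  have sc : ∀ g : Finset (Fin m) → ℝ, ∑ t ∈ ({c} : Finset (Fin m)).powerset, g t = g ∅ + g {c} := by
    intro g
    rw [ec, Finset.sum_powerset_insert (Finset.notMem_empty c)]
    simp
  simp only [Finset.sum_powerset_insert io, Finset.sum_powerset_insert ia,
    Finset.sum_powerset_insert ib, sc, insert_empty_eq] at this
  simp [h1, h2, h3, h4, h5, h6, Finset.card_insert_of_notMem] at this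
  linarith

theorem S_empty {m : ℕ} (ψ : (Fin m → Fin 2) → ℂ) (hψ : ∑ x, ‖ψ x‖ ^ 2 = 1) : Sent ψ ∅ = 0 := by
  have h := S_facts ψ hψ ∅
  have h1 := h.1
  simp at h1
  linarith [h.2.2.2.2]

theorem pur_empty {m : ℕ} (ψ : (Fin m → Fin 2) → ℂ) (hψ : ∑ x, ‖ψ x‖ ^ 2 = 1) : pur ψ ∅ = 1 := by
  have h := (S_facts ψ hψ ∅).2.1 (by simp [S_empty ψ hψ])
  simpa using h

theorem no_single {n : ℕ} (Γ : Finset (Fin n) → Prop) (hm : Monotonic Γ) (hc : NoCloning Γ)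
    (hr : NoRedundancy Γ) (i j : Fin n) (hij : i ≠ j) : ¬ Γ {i} := by
  intro hi
  obtain ⟨A, ⟨hA, hmin⟩, hj⟩ := hr j
  by_cases hiA : i ∈ A
  · refine hmin {i} ?_ hi
    rw [Finset.ssubset_iff_of_subset (by simpa using hiA)]
    exact ⟨j, hj, by simpa using hij.symm⟩
  · exact (hc A).1 hA (hm {i} Aᶜ hi (by simpa using hiA))

theorem Γ_univ {n : ℕ} (Γ : Finset (Fin n) → Prop) (hm : Monotonic Γ) (hc : NoCloning Γ) :
    Γ univ := by
  by_contra h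
  have h1 := (hc univ).not.1 h
  rw [not_not] at h1
  exact h (hm _ _ h1 (by simp))

theorem S_ref {n : ℕ} {Γ : Finset (Fin n) → Prop} (hm : Monotonic Γ) (hc : NoCloning Γ)
    {ψ : (Fin (n + 1) → Fin 2) → ℂ} (h : IsPureQSSState Γ ψ) : Sent ψ {0} = Real.log 2 := by
  have h1 := h.recover univ (Γ_univ Γ hm hc)
  have e1 : posOf (univ : Finset (Fin n)) = {0}ᶜ := by
    ext x
    simp only [posOf, Finset.mem_image, Finset.mem_univ, true_and, Finset.mem_compl, Finset.mem_singleton]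
    exact Fin.exists_succ_eq
  have e2 : insert 0 (posOf (univ : Finset (Fin n))) = ∅ᶜ := by
    rw [e1]; ext x; simp
  rw [e2, e1, S_compl, S_compl, S_empty ψ h.normalized] at h1
  linarith

theorem core3 (ψ : (Fin 4 → Fin 2) → ℂ) (hψ : ∑ x, ‖ψ x‖ ^ 2 = 1)
    (h0 : Sent ψ {0} = Real.log 2)
    (h1 : Sent ψ {0, 1} = Real.log 2 + Sent ψ {1})
    (h2 : Sent ψ {0, 2} = Real.log 2 + Sent ψ {2})
    (h3 : Sent ψ {0, 3} = Real.log 2 + Sent ψ {3}) : False := by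
  have L : ∀ A, _ := S_facts ψ hψ
  have c1 : Sent ψ {2, 3} = Sent ψ {0, 1} := by rw [← S_compl]; congr 1
  have c2 : Sent ψ {1, 3} = Sent ψ {0, 2} := by rw [← S_compl]; congr 1
  have c3 : Sent ψ {1, 2} = Sent ψ {0, 3} := by rw [← S_compl]; congr 1
  have s1 : Sent ψ {2, 3} ≤ Sent ψ {2} + Sent ψ {3} := S_subadd ψ hψ (A := {2}) (B := {3}) (by decide)
  have s2 : Sent ψ {1, 3} ≤ Sent ψ {1} + Sent ψ {3} := S_subadd ψ hψ (A := {1}) (B := {3}) (by decide)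
  have s3 : Sent ψ {1, 2} ≤ Sent ψ {1} + Sent ψ {2} := S_subadd ψ hψ (A := {1}) (B := {2}) (by decide)
  have b1 : Sent ψ {1} ≤ Real.log 2 := by simpa using (L {1}).1
  have b2 : Sent ψ {2} ≤ Real.log 2 := by simpa using (L {2}).1
  have b3 : Sent ψ {3} ≤ Real.log 2 := by simpa using (L {3}).1
  have q0 : 1 / 2 ≤ pur ψ {0} := by simpa using (L {0}).2.2.1
  have q1 : 1 / 2 ≤ pur ψ {1} := by simpa using (L {1}).2.2.1
  have q2 : 1 / 2 ≤ pur ψ {2} := by simpa using (L {2}).2.2.1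
  have q3 : 1 / 2 ≤ pur ψ {3} := by simpa using (L {3}).2.2.1
  have two : ∀ A : Finset (Fin 4), A.card = 2 → 2 * Real.log 2 ≤ Sent ψ A → pur ψ A = 1 / 4 := by
    intro A hA h
    have := (L A).2.1 (by rw [hA]; exact_mod_cast h)
    rw [this, hA]; norm_num
  have p01 := two {0, 1} (by decide) (by linarith)
  have p02 := two {0, 2} (by decide) (by linarith)
  have p03 := two {0, 3} (by decide) (by linarith)
  have p12 := two {1, 2} (by decide) (by linarith)
  have p13 := two {1, 3} (by decide) (by linarith)
  have p23 := two {2, 3} (by decide) (by linarith)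
  have t1 : pur ψ {0, 1, 2} = pur ψ {3} := by rw [← pur_compl]; congr 1
  have t2 : pur ψ {0, 1, 3} = pur ψ {2} := by rw [← pur_compl]; congr 1
  have t3 : pur ψ {0, 2, 3} = pur ψ {1} := by rw [← pur_compl]; congr 1
  have t4 : pur ψ {1, 2, 3} = pur ψ {0} := by rw [← pur_compl]; congr 1
  have t5 : pur ψ {0, 1, 2, 3} = pur ψ ∅ := by rw [← pur_compl]; congr 1
  have e := pur_empty ψ hψ
  have := shadow4 ψ 0 1 2 3 (by decide)
  linarith

theorem un1 (b c d : Fin 5) : ({b, c} ∪ {d} : Finset (Fin 5)) = {b, c, d} := by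
  ext; simp

theorem un2 (b c d : Fin 5) : ({b, d} ∪ {c} : Finset (Fin 5)) = {b, c, d} := by
  ext; simp; tauto

theorem un3 (b c : Fin 5) : ({b, c} ∪ {0} : Finset (Fin 5)) = {0, b, c} := by
  ext; simp; tauto

theorem core4 (ψ : (Fin 5 → Fin 2) → ℂ) (hψ : ∑ x, ‖ψ x‖ ^ 2 = 1) (a b c d : Fin 5)
    (hd : ({0, a}ᶜ : Finset (Fin 5)) = {b, c, d} ∧ ({0, b}ᶜ : Finset (Fin 5)) = {a, c, d} ∧
      ({0, c}ᶜ : Finset (Fin 5)) = {a, b, d} ∧ ({0, d}ᶜ : Finset (Fin 5)) = {a, b, c} ∧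
      ({0, b, c}ᶜ : Finset (Fin 5)) = {a, d} ∧ ({0, b, d}ᶜ : Finset (Fin 5)) = {a, c} ∧
      ({0, c, d}ᶜ : Finset (Fin 5)) = {a, b} ∧
      ({0, a, b}ᶜ : Finset (Fin 5)) = {c, d} ∧ ({0, a, c}ᶜ : Finset (Fin 5)) = {b, d} ∧
      ({0, a, b, c}ᶜ : Finset (Fin 5)) = {d})
    (hne : (0 ≠ a ∧ 0 ≠ b ∧ 0 ≠ c ∧ a ≠ b ∧ a ≠ c ∧ b ≠ c) ∧ 0 ≠ d ∧ a ≠ d ∧ b ≠ d ∧ c ≠ d)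
    (h0 : Sent ψ {0} = Real.log 2)
    (ha : Sent ψ {0, a} = Real.log 2 + Sent ψ {a})
    (hb : Sent ψ {0, b} = Real.log 2 + Sent ψ {b})
    (hc : Sent ψ {0, c} = Real.log 2 + Sent ψ {c})
    (hdd : Sent ψ {0, d} = Real.log 2 + Sent ψ {d})
    (hbc : Sent ψ {0, b, c} = Real.log 2 + Sent ψ {b, c})
    (hbd : Sent ψ {0, b, d} = Real.log 2 + Sent ψ {b, d})
    (hcd : Sent ψ {0, c, d} = Real.log 2 + Sent ψ {c, d}) : False := by
  obtain ⟨e1, e2, e3, e4, e5, e6, e7, e8, e9, e10⟩ := hd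
  obtain ⟨hne', n1, n2, n3, n4⟩ := hne
  obtain ⟨m1, m2, m3, m4, m5, m6⟩ := hne'
  have L : ∀ A, _ := S_facts ψ hψ
  have b1 : ∀ x, Sent ψ {x} ≤ Real.log 2 := fun x => by simpa using (L {x}).1
  have q1 : ∀ x, 1 / 2 ≤ pur ψ {x} := fun x => by simpa using (L {x}).2.2.1
  have q2 : ∀ x y, x ≠ y → 1 / 4 ≤ pur ψ {x, y} := fun x y h => by
    have := (L {x, y}).2.2.1
    rw [Finset.card_pair h] at this
    linarith
  have two : ∀ x y, x ≠ y → 2 * Real.log 2 ≤ Sent ψ {x, y} → pur ψ {x, y} = 1 / 4 := by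
    intro x y hxy h
    have := (L {x, y}).2.1 (by rw [Finset.card_pair hxy]; exact_mod_cast h)
    rw [this, Finset.card_pair hxy]; norm_num
  have half : ∀ A, Sent ψ A ≤ Real.log 2 → 1 / 2 ≤ pur ψ A := fun A => (L A).2.2.2.1
  have sub2 : ∀ x y, x ≠ y → Sent ψ {x, y} ≤ Sent ψ {x} + Sent ψ {y} := fun x y h =>
    S_subadd ψ hψ (A := {x}) (B := {y}) (by simpa using h)
  have c1 : Sent ψ {b, c, d} = Sent ψ {0, a} := by rw [← e1, S_compl]
  have c2 : Sent ψ {a, c, d} = Sent ψ {0, b} := by rw [← e2, S_compl]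
  have c5 : Sent ψ {a, d} = Sent ψ {0, b, c} := by rw [← e5, S_compl]
  have c6 : Sent ψ {a, c} = Sent ψ {0, b, d} := by rw [← e6, S_compl]
  have c7 : Sent ψ {a, b} = Sent ψ {0, c, d} := by rw [← e7, S_compl]
  have s1 : Sent ψ {b, c, d} ≤ Sent ψ {b, c} + Sent ψ {d} := by
    have := S_subadd ψ hψ (A := {b, c}) (B := {d}) (by simp [n3.symm, n4.symm])
    rwa [un1] at this
  have s2 : Sent ψ {b, c, d} ≤ Sent ψ {b} + Sent ψ {c, d} :=
    S_subadd ψ hψ (A := {b}) (B := {c, d}) (by simp [m6, n3])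
  have s3 : Sent ψ {b, c, d} ≤ Sent ψ {b, d} + Sent ψ {c} := by
    have := S_subadd ψ hψ (A := {b, d}) (B := {c}) (by simp [m6.symm, n4])
    rwa [un2] at this
  have s4 : Sent ψ {a, c, d} ≤ Sent ψ {a} + Sent ψ {c, d} :=
    S_subadd ψ hψ (A := {a}) (B := {c, d}) (by simp [m5, n2])
  have u1 := sub2 a b m4
  have u2 := sub2 a c m5
  have u3 := sub2 a d n2
  have v1 := b1 a
  have v2 := b1 b
  have v3 := b1 c
  have v4 := b1 d
  have pd : pur ψ {d} = 1 / 2 := by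
    have := (L {d}).2.1 (by simp; linarith)
    simpa using this
  have p0a := two 0 a m1 (by linarith)
  have p0b := two 0 b m2 (by linarith)
  have p0c := two 0 c m3 (by linarith)
  have pab := two a b m4 (by linarith)
  have pac := two a c m5 (by linarith)
  have pad := two a d n2 (by linarith)
  have pcd := half {c, d} (by linarith)
  have pbd := half {b, d} (by linarith)
  have p0bc : pur ψ {0, b, c} = pur ψ {a, d} := by rw [← e5, pur_compl]
  have p0ab : pur ψ {0, a, b} = pur ψ {c, d} := by rw [← e8, pur_compl]
  have p0ac : pur ψ {0, a, c} = pur ψ {b, d} := by rw [← e9, pur_compl]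
  have pabc : pur ψ {a, b, c} = pur ψ {0, d} := by rw [← e4, pur_compl]
  have p0abc : pur ψ {0, a, b, c} = pur ψ {d} := by rw [← e10, pur_compl]
  have p0d := q2 0 d n1
  have pbc : pur ψ {b, c} ≤ 2 * pur ψ {0, b, c} := by
    have := pur_mono ψ (A := {b, c}) (B := {0}) (by simp [m2, m3])
    rw [un3] at this
    simpa using this
  have e := pur_empty ψ hψ
  have := shadow4 ψ 0 a b c ⟨m1, m2, m3, m4, m5, m6⟩
  linarith [q1 0, q1 a, q1 b, q1 c]

theorem sec' {n : ℕ} {Γ : Finset (Fin n) → Prop} (hm : Monotonic Γ) (hc : NoCloning Γ)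
    {ψ : (Fin (n + 1) → Fin 2) → ℂ} (h : IsPureQSSState Γ ψ) (B : Finset (Fin n)) (hB : ¬ Γ B) :
    Sent ψ (insert 0 (posOf B)) = Real.log 2 + Sent ψ (posOf B) := by
  have := h.secrecy B hB
  rw [S_ref hm hc h] at this
  linarith

theorem star4 (Γ : Finset (Fin 4) → Prop) (hm : Monotonic Γ) (hc : NoCloning Γ)
    (hr : NoRedundancy Γ) (a b c d : Fin 4)
    (hab : ({a, b}ᶜ : Finset (Fin 4)) = {c, d}) (hac : ({a, c}ᶜ : Finset (Fin 4)) = {b, d})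
    (had : ({a, d}ᶜ : Finset (Fin 4)) = {b, c})
    (hA : ∀ A : Finset (Fin 4), a ∈ A → A ⊆ {a, b} ∨ A ⊆ {a, c} ∨ A ⊆ {a, d} ∨
      {b, c} ⊂ A ∨ {b, d} ⊂ A ∨ {c, d} ⊂ A)
    (hbc : Γ {b, c}) (hbd : Γ {b, d}) (hcd : Γ {c, d}) :
    False := by
  obtain ⟨A, ⟨h1, h2⟩, h3⟩ := hr a
  rcases hA A h3 with h | h | h | h | h | h
  · exact (hc _).1 (hm _ _ h1 h) (hab ▸ hcd)
  · exact (hc _).1 (hm _ _ h1 h) (hac ▸ hbd)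
  · exact (hc _).1 (hm _ _ h1 h) (had ▸ hbc)
  · exact h2 _ h hbc
  · exact h2 _ h hbd
  · exact h2 _ h hcd

theorem stmt12 (n : ℕ) (hn : n = 3 ∨ n = 4) :
    ¬ ∃ (Γ : Finset (Fin n) → Prop) (ψ : (Fin (n + 1) → Fin 2) → ℂ),
      Monotonic Γ ∧ NoCloning Γ ∧ NoRedundancy Γ ∧ IsPureQSSState Γ ψ := by
  rintro ⟨Γ, ψ, hm, hc, hr, h⟩
  have hs := sec' hm hc h
  have h0 := S_ref hm hc h
  rcases hn with rfl | rfl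
  · have g : ∀ i, ¬ Γ {i} := fun i => no_single Γ hm hc hr i (i + 1) (by revert i; decide)
    exact core3 ψ h.normalized h0 (hs {0} (g 0)) (hs {1} (g 1)) (hs {2} (g 2))
  · have g : ∀ i, ¬ Γ {i} := fun i => no_single Γ hm hc hr i (i + 1) (by revert i; decide)
    have i0 := hs {0} (g 0)
    have i1 := hs {1} (g 1)
    have i2 := hs {2} (g 2)
    have i3 := hs {3} (g 3)
    have nn := h.normalized
    have k1 : Γ {0, 1} ↔ ¬ Γ {2, 3} := hc {0, 1}
    have k2 : Γ {0, 2} ↔ ¬ Γ {1, 3} := hc {0, 2}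
    have k3 : Γ {0, 3} ↔ ¬ Γ {1, 2} := hc {0, 3}
    have l1 : Γ {2, 3} ∨ ¬ Γ {2, 3} := em _
    have l2 : Γ {1, 3} ∨ ¬ Γ {1, 3} := em _
    have l3 : Γ {1, 2} ∨ ¬ Γ {1, 2} := em _
    rcases l1 with l1 | l1 <;> rcases l2 with l2 | l2 <;> rcases l3 with l3 | l3 <;>
      simp only [l1, l2, l3, not_true, not_false_iff, iff_true, iff_false] at k1 k2 k3
    · exact star4 Γ hm hc hr 0 1 2 3 (by decide) (by decide) (by decide) (by decide) l3 l2 l1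
    · exact core4 ψ nn 4 1 2 3 (by decide) (by decide) h0 i3 i0 i1 i2
        (hs {0, 1} k1) (hs {0, 2} k2) (hs {1, 2} l3)
    · exact core4 ψ nn 3 1 2 4 (by decide) (by decide) h0 i2 i0 i1 i3
        (hs {0, 1} k1) (hs {0, 3} k3) (hs {1, 3} l2)
    · exact star4 Γ hm hc hr 1 0 2 3 (by decide) (by decide) (by decide) (by decide) k2 k3 l1
    · exact core4 ψ nn 2 1 3 4 (by decide) (by decide) h0 i1 i0 i2 i3
        (hs {0, 2} k2) (hs {0, 3} k3) (hs {2, 3} l1)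
    · exact star4 Γ hm hc hr 2 0 1 3 (by decide) (by decide) (by decide) (by decide) k1 k3 l2
    · exact star4 Γ hm hc hr 3 0 1 2 (by decide) (by decide) (by decide) (by decide) k1 k2 l3
    · exact core4 ψ nn 1 2 3 4 (by decide) (by decide) h0 i0 i1 i2 i3
        (hs {1, 2} l3) (hs {1, 3} l2) (hs {2, 3} l1)
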